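/- Let m ≥ 2 and n ≥ 3 be integers. Define G_0(y) = y, G_j(y) = exp(G_{j−1}(y)), H_0(y) = y, H_j(y) = ln(H_{j−1}(y)), and φ(t) = ln(2(n−2)·H_m'(2t)) for t large. There exist a real number T* and a function w : ℝ → ℝ, continuous on [T*, ∞) and twice continuously differentiable on (T*, ∞), such that w''(t) − (n−2)·w'(t) + exp(−2t + G_m(w(t))) = 0 and w(t) > 0 for all t > T*, w(T*) = 0, w(t) − H_m(2t + φ(t)) = O(1/t²) as t → ∞, and w'(t) = 2·H_m'(2t) + O(1/t²) as t → ∞. -/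

import Mathlib

/-- The iterated exponential: `G₀(y) = y`, `G_{j+1}(y) = exp(G_j(y))`. -/
noncomputable def iterExp : ℕ → ℝ → ℝ
  | 0 => fun y => y
  | (j + 1) => fun y => Real.exp (iterExp j y)

/-- The iterated logarithm: `H₀(y) = y`, `H_{j+1}(y) = ln(H_j(y))`. -/
noncomputable def iterLog : ℕ → ℝ → ℝ
  | 0 => fun y => y
  | (j + 1) => fun y => Real.log (iterLog j y)

/-- `φ(t) = ln(2(n-2) H_m'(2t))`. -/
noncomputable def phiIter (m n : ℕ) (t : ℝ) : ℝ :=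
  Real.log (2 * ((n : ℝ) - 2) * deriv (iterLog m) (2 * t))

/-- The solution operator of `y' = r y + g`, integrating from infinity. -/
noncomputable def backwardIntegral (r : ℂ) (g : ℝ → ℂ) (t : ℝ) : ℂ :=
  -(Complex.exp (r * t) * ∫ s in Set.Ioi t, g s * Complex.exp (-r * s))

theorem backwardIntegral_integrableOn {r : ℂ} (hr : 0 < r.re) {g : ℝ → ℂ} (hg : Continuous g)
    {M : ℝ} (hM : ∀ t, ‖g t‖ ≤ M) (t : ℝ) :
    MeasureTheory.IntegrableOn (fun s : ℝ => g s * Complex.exp (-r * s)) (Set.Ioi t) :=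
  MeasureTheory.Integrable.bdd_mul (c := M)
    (integrableOn_exp_mul_complex_Ioi (a := -r) (by simpa using hr) t)
    hg.aestronglyMeasurable (Filter.Eventually.of_forall hM)

theorem hasDerivAt_backwardIntegral {r : ℂ} (hr : 0 < r.re) {g : ℝ → ℂ} (hg : Continuous g)
    {M : ℝ} (hM : ∀ t, ‖g t‖ ≤ M) (t : ℝ) :
    HasDerivAt (backwardIntegral r g) (r * backwardIntegral r g t + g t) t := by
  have hc : Continuous (fun s : ℝ => g s * Complex.exp (-r * s)) := by fun_prop
  set I := ∫ s in Set.Ioi (0 : ℝ), g s * Complex.exp (-r * s) with hI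
  have hform : ∀ x : ℝ, backwardIntegral r g x
      = -(Complex.exp (r * x) * (I - ∫ s in (0 : ℝ)..x, g s * Complex.exp (-r * s))) := by
    intro x
    rw [backwardIntegral, ← intervalIntegral.integral_Ioi_sub_Ioi'
      (backwardIntegral_integrableOn hr hg hM 0) (backwardIntegral_integrableOn hr hg hM x),
      ← hI, sub_sub_cancel]
  have h1 : HasDerivAt (fun x : ℝ => ∫ s in (0 : ℝ)..x, g s * Complex.exp (-r * s))
      (g t * Complex.exp (-r * t)) t :=
    intervalIntegral.integral_hasDerivAt_right (hc.intervalIntegrable _ _)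
      hc.aestronglyMeasurable.stronglyMeasurableAtFilter hc.continuousAt
  have h2 : HasDerivAt (fun x : ℝ => Complex.exp (r * x)) (Complex.exp (r * t) * (r * 1)) t :=
    ((Complex.ofRealCLM.hasDerivAt (x := t)).const_mul r).cexp
  have h3 := (h2.mul (h1.const_sub I)).neg
  have he : Complex.exp (r * t) * Complex.exp (-r * t) = 1 := by
    rw [← Complex.exp_add]; simp
  rw [funext hform]
  refine h3.congr_deriv ?_
  linear_combination g t * he

theorem norm_backwardIntegral_le {r : ℂ} (hr : 0 < r.re) {g : ℝ → ℂ} {t β : ℝ}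
    (hβ : ∀ s, t ≤ s → ‖g s‖ ≤ β) :
    ‖backwardIntegral r g t‖ ≤ β / r.re := by
  have hint : MeasureTheory.IntegrableOn (fun s : ℝ => Real.exp (-r.re * s)) (Set.Ioi t) :=
    integrableOn_exp_mul_Ioi (by linarith) t
  have h := MeasureTheory.norm_integral_le_of_norm_le (f := fun s : ℝ => g s * Complex.exp (-r * s))
    (hint.const_mul β) (MeasureTheory.ae_restrict_of_forall_mem measurableSet_Ioi (fun s hs => by
      rw [norm_mul, Complex.norm_exp]
      simp only [Complex.mul_re, Complex.neg_re, Complex.ofReal_re, Complex.ofReal_im, mul_zero,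
        sub_zero]
      exact mul_le_mul_of_nonneg_right (hβ s hs.le) (Real.exp_pos _).le))
  rw [MeasureTheory.integral_const_mul, integral_exp_mul_Ioi (by linarith)] at h
  rw [backwardIntegral, norm_neg, norm_mul, Complex.norm_exp]
  simp only [Complex.mul_re, Complex.ofReal_re, Complex.ofReal_im, mul_zero, sub_zero]
  calc _ ≤ Real.exp (r.re * t) * (β * (-Real.exp (-r.re * t) / -r.re)) :=
        mul_le_mul_of_nonneg_left h (Real.exp_pos _).le
    _ = Real.exp (r.re * t) * Real.exp (-r.re * t) * (β / r.re) := by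
        rw [neg_div_neg_eq]; ring
    _ = β / r.re := by rw [← Real.exp_add]; simp

theorem backwardIntegral_sub {r : ℂ} (hr : 0 < r.re) {f g : ℝ → ℂ} (hf : Continuous f)
    (hg : Continuous g) {M N : ℝ} (hM : ∀ t, ‖f t‖ ≤ M) (hN : ∀ t, ‖g t‖ ≤ N) (t : ℝ) :
    backwardIntegral r f t - backwardIntegral r g t
      = backwardIntegral r (fun s => f s - g s) t := by
  simp only [backwardIntegral, sub_mul]
  rw [MeasureTheory.integral_sub (backwardIntegral_integrableOn hr hf hM t)
    (backwardIntegral_integrableOn hr hg hN t)]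
  ring

/-- The characteristic polynomial `X² - k X + 2 k` splits over `ℂ` with both roots in the right
half plane. -/
theorem exists_roots_re_pos {k : ℝ} (hk : 0 < k) :
    ∃ r₁ r₂ : ℂ, 0 < r₁.re ∧ 0 < r₂.re ∧ r₁ + r₂ = k ∧ r₁ * r₂ = 2 * k := by
  obtain ⟨s, hs⟩ := IsAlgClosed.exists_pow_nat_eq ((k : ℂ) ^ 2 - 8 * k) two_pos
  have key : ∀ r : ℂ, r ^ 2 - k * r + 2 * k = 0 → 0 < r.re := by
    intro r h
    have h1 := congrArg Complex.re h
    have h2 := congrArg Complex.im h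
    simp [pow_two] at h1 h2
    have h3 : r.im * (2 * r.re - k) = 0 := by linarith
    rcases mul_eq_zero.1 h3 with h4 | h4
    · rw [h4] at h1
      nlinarith [mul_self_nonneg r.re]
    · linarith
  refine ⟨(k + s) / 2, (k - s) / 2, key _ ?_, key _ ?_, by ring, ?_⟩
  · linear_combination hs / 4
  · linear_combination hs / 4
  · linear_combination -hs / 4

/-- A perturbation of the backward-stable oscillator `z'' - k z' + 2 k z = 0` by a small Lipschitz
nonlinearity dominated by an antitone function has a solution dominated by that function. -/
theorem exists_bounded_solution {k : ℝ} (hk : 0 < k) :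
    ∃ c > (0 : ℝ), ∀ (R : ℝ → ℝ → ℝ) (b : ℝ → ℝ) (M : ℝ),
      Continuous (Function.uncurry R) → Antitone b → (∀ t, b t ≤ M) →
      (∀ t z, |R t z| ≤ b t) → (∀ t z₁ z₂, |R t z₁ - R t z₂| ≤ c * |z₁ - z₂|) →
      ∃ z v : ℝ → ℝ, ∀ t, HasDerivAt z (v t) t ∧
        HasDerivAt v (k * v t - 2 * k * z t + R t (z t)) t ∧
        |z t| ≤ b t / c ∧ |v t| ≤ b t / c := by
  obtain ⟨r₁, r₂, h1, h2, hsum, hprod⟩ := exists_roots_re_pos hk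
  set a := r₁.re * r₂.re with ha
  have hapos : 0 < a := mul_pos h1 h2
  set q := ‖r₁‖ / a + 1 / r₂.re with hq
  have hqpos : 0 < q := by positivity
  refine ⟨min (a / 2) (1 / q), by positivity, ?_⟩
  intro R b M hR hb hbM hRb hRL
  set c := min (a / 2) (1 / q) with hc
  have hcpos : 0 < c := by positivity
  have hca : c ≤ a / 2 := min_le_left _ _
  have hcq : c ≤ 1 / q := min_le_right _ _
  have hb0 : ∀ t, 0 ≤ b t := fun t => (abs_nonneg _).trans (hRb t 0)
  set src : BoundedContinuousFunction ℝ ℝ → ℝ → ℂ := fun ζ s => ((R s (ζ s) : ℝ) : ℂ) with hsrc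
  have hsrc_cont : ∀ ζ, Continuous (src ζ) := fun ζ =>
    Complex.continuous_ofReal.comp (hR.comp (continuous_id.prodMk ζ.continuous))
  have hsrc_le : ∀ ζ t, ‖src ζ t‖ ≤ b t := fun ζ t => by
    simpa [hsrc] using hRb t (ζ t)
  have hsrc_M : ∀ ζ t, ‖src ζ t‖ ≤ M := fun ζ t => (hsrc_le ζ t).trans (hbM t)
  have hY_der := fun ζ => hasDerivAt_backwardIntegral h2 (hsrc_cont ζ) (hsrc_M ζ)
  have hY_cont : ∀ ζ, Continuous (backwardIntegral r₂ (src ζ)) := fun ζ =>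
    continuous_iff_continuousAt.2 fun t => (hY_der ζ t).continuousAt
  have hY_le : ∀ ζ t, ‖backwardIntegral r₂ (src ζ) t‖ ≤ b t / r₂.re := fun ζ t =>
    norm_backwardIntegral_le h2 fun s hs => (hsrc_le ζ s).trans (hb hs)
  have hY_M : ∀ ζ t, ‖backwardIntegral r₂ (src ζ) t‖ ≤ M / r₂.re := fun ζ t =>
    (hY_le ζ t).trans (by gcongr; exact hbM t)
  have hZ_der := fun ζ => hasDerivAt_backwardIntegral h1 (hY_cont ζ) (hY_M ζ)
  have hZ_cont : ∀ ζ, Continuous (backwardIntegral r₁ (backwardIntegral r₂ (src ζ))) := fun ζ =>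
    continuous_iff_continuousAt.2 fun t => (hZ_der ζ t).continuousAt
  have hZ_le : ∀ ζ t, ‖backwardIntegral r₁ (backwardIntegral r₂ (src ζ)) t‖ ≤ b t / a := by
    intro ζ t
    have := norm_backwardIntegral_le h1 (t := t) fun s hs =>
      (hY_le ζ s).trans (div_le_div_of_nonneg_right (hb hs) h2.le)
    rwa [div_div, mul_comm r₂.re, ← ha] at this
  set Φ : BoundedContinuousFunction ℝ ℝ → BoundedContinuousFunction ℝ ℝ := fun ζ =>
    BoundedContinuousFunction.ofNormedAddCommGroup
      (fun t => (backwardIntegral r₁ (backwardIntegral r₂ (src ζ)) t).re)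
      (Complex.continuous_re.comp (hZ_cont ζ)) (M / a) (fun t =>
        (Complex.abs_re_le_norm _).trans ((hZ_le ζ t).trans (by gcongr; exact hbM t))) with hΦ
  have hΦ_app : ∀ ζ t, Φ ζ t = (backwardIntegral r₁ (backwardIntegral r₂ (src ζ)) t).re :=
    fun ζ t => rfl
  have hcontr : ContractingWith (1 / 2) Φ := by
    refine ⟨by rw [← NNReal.coe_lt_coe]; norm_num, LipschitzWith.of_dist_le_mul fun ζ η => ?_⟩
    refine (BoundedContinuousFunction.dist_le (by positivity)).2 fun t => ?_
    rw [Real.dist_eq, hΦ_app, hΦ_app, ← Complex.sub_re,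
      backwardIntegral_sub h1 (hY_cont ζ) (hY_cont η) (hY_M ζ) (hY_M η)]
    refine (Complex.abs_re_le_norm _).trans ?_
    have hd : ∀ s, ‖src ζ s - src η s‖ ≤ c * dist ζ η := by
      intro s
      rw [hsrc]
      simp only
      rw [← Complex.ofReal_sub, Complex.norm_real, Real.norm_eq_abs]
      refine (hRL s _ _).trans ?_
      gcongr
      rw [← Real.dist_eq]
      exact BoundedContinuousFunction.dist_coe_le_dist s
    have hY : ∀ s, ‖backwardIntegral r₂ (src ζ) s - backwardIntegral r₂ (src η) s‖
        ≤ c * dist ζ η / r₂.re := by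
      intro s
      rw [backwardIntegral_sub h2 (hsrc_cont ζ) (hsrc_cont η) (hsrc_M ζ) (hsrc_M η)]
      exact norm_backwardIntegral_le h2 fun s _ => hd s
    refine (norm_backwardIntegral_le h1 fun s _ => hY s).trans ?_
    rw [div_div, mul_comm r₂.re, ← ha, div_le_iff₀ hapos]
    have : c * dist ζ η ≤ a / 2 * dist ζ η := by gcongr
    push_cast
    linarith
  set ζ := hcontr.fixedPoint Φ with hζ
  have hfix : Φ ζ = ζ := hcontr.fixedPoint_isFixedPt
  set Y := backwardIntegral r₂ (src ζ) with hY
  set Z := backwardIntegral r₁ Y with hZ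
  have hζZ : ∀ t, ζ t = (Z t).re := fun t => by rw [← hΦ_app, hfix]
  have hre : ∀ {f : ℝ → ℂ} {f' : ℂ} {t : ℝ}, HasDerivAt f f' t →
      HasDerivAt (fun x => (f x).re) f'.re t := fun h =>
    (Complex.reCLM.hasFDerivAt.comp_hasDerivAt _ h)
  refine ⟨fun t => (Z t).re, fun t => (r₁ * Z t + Y t).re, fun t => ⟨hre (hZ_der ζ t), ?_, ?_, ?_⟩⟩
  · have := hre (((hZ_der ζ t).const_mul r₁).add (hY_der ζ t))
    refine this.congr_deriv ?_
    have e : r₁ * (r₁ * Z t + Y t) + (r₂ * Y t + src ζ t)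
        = k * (r₁ * Z t + Y t) - (2 * k : ℝ) * Z t + (R t (ζ t) : ℝ) := by
      push_cast
      simp only [hsrc]
      linear_combination (r₁ * Z t + Y t) * hsum - Z t * hprod
    rw [e]
    simp only [Complex.add_re, Complex.sub_re, Complex.re_ofReal_mul, Complex.ofReal_re, hζZ]
  · refine (Complex.abs_re_le_norm _).trans ((hZ_le ζ t).trans ?_)
    exact div_le_div_of_nonneg_left (hb0 t) hcpos (by linarith)
  · refine (Complex.abs_re_le_norm _).trans ((norm_add_le _ _).trans ?_)
    rw [norm_mul]
    calc ‖r₁‖ * ‖Z t‖ + ‖Y t‖ ≤ ‖r₁‖ * (b t / a) + b t / r₂.re := by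
          gcongr
          · exact hZ_le ζ t
          · exact hY_le ζ t
      _ = b t * q := by rw [hq]; ring
      _ ≤ b t / c := by
          rw [div_eq_mul_inv]
          refine mul_le_mul_of_nonneg_left ?_ (hb0 t)
          rw [le_inv_comm₀ hqpos hcpos]
          simpa using hcq

open Filter Topology Asymptotics in
theorem tendsto_iterLog (j : ℕ) : Tendsto (iterLog j) atTop atTop := by
  induction j with
  | zero => exact tendsto_id
  | succ j ih => exact Real.tendsto_log_atTop.comp ih

theorem iterExp_succ' (j : ℕ) (y : ℝ) : iterExp (j + 1) y = iterExp j (Real.exp y) := by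
  induction j with
  | zero => rfl
  | succ j ih => exact congrArg Real.exp ih

theorem contDiff_iterExp (j : ℕ) : ContDiff ℝ 1 (iterExp j) := by
  induction j with
  | zero => exact contDiff_id
  | succ j ih => exact Real.contDiff_exp.comp ih

theorem iterExp_mono (j : ℕ) : Monotone (iterExp j) := by
  induction j with
  | zero => exact monotone_id
  | succ j ih => exact Real.exp_monotone.comp ih

theorem iterExp_nonneg (j : ℕ) {y : ℝ} (hy : 0 ≤ y) : 0 ≤ iterExp j y := by
  cases j with
  | zero => exact hy
  | succ j => exact (Real.exp_pos _).le

/-- The derivative of the iterated exponential. -/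
noncomputable def iterExpDeriv (j : ℕ) (y : ℝ) : ℝ := ∏ i ∈ Finset.range j, iterExp (i + 1) y

/-- The reciprocal of the derivative of the iterated logarithm near infinity. -/
noncomputable def logProd (j : ℕ) (y : ℝ) : ℝ := ∏ i ∈ Finset.range j, iterLog i y

/-- The logarithm of `logProd`. -/
noncomputable def logSum (j : ℕ) (y : ℝ) : ℝ := ∑ i ∈ Finset.range j, iterLog (i + 1) y

/-- The derivative of `logSum` near infinity. -/
noncomputable def logSumDeriv (j : ℕ) (y : ℝ) : ℝ :=
  ∑ i ∈ Finset.range j, Real.exp (-logSum (i + 1) y)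

/-- The second derivative of `logSum` near infinity. -/
noncomputable def logSumDeriv₂ (j : ℕ) (y : ℝ) : ℝ :=
  ∑ i ∈ Finset.range j, Real.exp (-logSum (i + 1) y) * -logSumDeriv (i + 1) y

theorem hasDerivAt_iterExp (j : ℕ) (y : ℝ) : HasDerivAt (iterExp j) (iterExpDeriv j y) y := by
  induction j with
  | zero => simpa [iterExpDeriv, iterExp] using! hasDerivAt_id y
  | succ j ih =>
    refine ih.exp.congr_deriv ?_
    rw [iterExpDeriv, iterExpDeriv, Finset.prod_range_succ, mul_comm]
    rfl

theorem iterExpDeriv_succ (j : ℕ) (y : ℝ) :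
    iterExpDeriv (j + 1) y = Real.exp y * iterExpDeriv j (Real.exp y) := by
  rw [iterExpDeriv, Finset.prod_range_succ', mul_comm]
  simp only [iterExp_succ' (_ + 1), iterExpDeriv]
  rfl

theorem eventually_iterLog_ge (j : ℕ) (c : ℝ) : ∀ᶠ y in Filter.atTop, c ≤ iterLog j y :=
  (tendsto_iterLog j).eventually_ge_atTop c

theorem eventually_iterLog_pos (m : ℕ) :
    ∀ᶠ y in Filter.atTop, ∀ j ∈ Finset.range m, 1 ≤ iterLog j y :=
  (Filter.eventually_all_finset _).2 fun j _ => eventually_iterLog_ge j 1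

theorem eventually_iterExp_iterLog (m : ℕ) :
    ∀ᶠ y in Filter.atTop, iterExp m (iterLog m y) = y ∧
      iterExpDeriv m (iterLog m y) = logProd m y := by
  induction m with
  | zero => simp [iterExp, iterLog, iterExpDeriv, logProd]
  | succ m ih =>
    filter_upwards [ih, eventually_iterLog_ge m 1] with y hy hpos
    have he : Real.exp (iterLog (m + 1) y) = iterLog m y := Real.exp_log (by linarith)
    refine ⟨by rw [iterExp_succ', he, hy.1], ?_⟩
    rw [iterExpDeriv_succ, he, hy.2, logProd, logProd, Finset.prod_range_succ, mul_comm]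

theorem eventually_exp_logSum (m : ℕ) :
    ∀ᶠ y in Filter.atTop, Real.exp (logSum m y) = logProd m y := by
  filter_upwards [eventually_iterLog_pos m] with y hy
  rw [logSum, Real.exp_sum, logProd]
  exact Finset.prod_congr rfl fun i hi => Real.exp_log (by linarith [hy i hi])

theorem eventually_hasDerivAt_iterLog (m : ℕ) :
    ∀ᶠ y in Filter.atTop, HasDerivAt (iterLog m) (Real.exp (-logSum m y)) y := by
  induction m with
  | zero =>
    refine Filter.Eventually.of_forall fun y => ?_
    simpa [logSum] using! hasDerivAt_id y
  | succ m ih =>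
    filter_upwards [ih, eventually_iterLog_ge m 1] with y hy hpos
    refine (hy.log (by linarith)).congr_deriv ?_
    rw [logSum, logSum, Finset.sum_range_succ, neg_add, Real.exp_add, Real.exp_neg (iterLog _ _),
      iterLog, Real.exp_log (by linarith), div_eq_mul_inv]

theorem eventually_hasDerivAt_logSum (m : ℕ) :
    ∀ᶠ y in Filter.atTop, HasDerivAt (logSum m) (logSumDeriv m y) y := by
  have : ∀ᶠ y in Filter.atTop, ∀ i ∈ Finset.range m,
      HasDerivAt (iterLog (i + 1)) (Real.exp (-logSum (i + 1) y)) y :=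
    (Filter.eventually_all_finset _).2 fun j _ => eventually_hasDerivAt_iterLog (j + 1)
  filter_upwards [this] with y hy
  exact HasDerivAt.fun_sum hy

theorem eventually_hasDerivAt_logSumDeriv (m : ℕ) :
    ∀ᶠ y in Filter.atTop, HasDerivAt (logSumDeriv m) (logSumDeriv₂ m y) y := by
  have : ∀ᶠ y in Filter.atTop, ∀ i ∈ Finset.range m,
      HasDerivAt (logSum (i + 1)) (logSumDeriv (i + 1) y) y :=
    (Filter.eventually_all_finset _).2 fun j _ => eventually_hasDerivAt_logSum (j + 1)
  filter_upwards [this] with y hy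
  exact HasDerivAt.fun_sum fun i hi => (hy i hi).neg.exp

theorem eventually_continuousAt_logSumDeriv₂ (m : ℕ) :
    ∀ᶠ y in Filter.atTop, ContinuousAt (logSumDeriv₂ m) y := by
  have : ∀ᶠ y in Filter.atTop, ∀ i ∈ Finset.range m,
      HasDerivAt (logSum (i + 1)) (logSumDeriv (i + 1) y) y ∧
      HasDerivAt (logSumDeriv (i + 1)) (logSumDeriv₂ (i + 1) y) y :=
    (Filter.eventually_all_finset _).2 fun j _ =>
      (eventually_hasDerivAt_logSum (j + 1)).and (eventually_hasDerivAt_logSumDeriv (j + 1))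
  filter_upwards [this] with y hy
  exact tendsto_finsetSum _ fun i hi =>
    (hy i hi).1.continuousAt.neg.rexp.mul (hy i hi).2.continuousAt.neg

theorem eventually_exp_neg_logSum_le {m : ℕ} (hm : 1 ≤ m) :
    ∀ᶠ y in Filter.atTop, Real.exp (-logSum m y) ≤ 1 / y := by
  filter_upwards [eventually_iterLog_pos (m + 1), Filter.eventually_gt_atTop 0] with y hy h0
  rw [one_div, ← Real.exp_log h0, ← Real.exp_neg, Real.exp_le_exp, Real.exp_log h0, neg_le_neg_iff]
  exact Finset.single_le_sum (f := fun i => iterLog (i + 1) y)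
    (fun i hi => by
      have := hy (i + 1) (by simpa using hi)
      linarith) (Finset.mem_range.2 (by omega : 0 < m))

theorem eventually_exp_neg_logSum_le_log {m : ℕ} (hm : 2 ≤ m) :
    ∀ᶠ y in Filter.atTop, Real.exp (-logSum m y) ≤ 1 / (y * Real.log y) := by
  filter_upwards [eventually_iterLog_pos (m + 1), Filter.eventually_gt_atTop 1] with y hy h0
  have hl : 0 < Real.log y := Real.log_pos h0
  have hp : 0 < y * Real.log y := by positivity
  rw [one_div, ← Real.exp_log hp, ← Real.exp_neg, Real.exp_le_exp, neg_le_neg_iff,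
    Real.log_mul (by linarith) hl.ne']
  have := Finset.sum_le_sum_of_subset_of_nonneg (f := fun i => iterLog (i + 1) y)
    (Finset.range_subset_range.2 hm)
    (fun i hi _ => by
      have := hy (i + 1) (by simpa using hi)
      linarith)
  rw [Finset.sum_range_succ, Finset.sum_range_one] at this
  exact this

theorem eventually_logSumDeriv_le (m : ℕ) :
    ∀ᶠ y in Filter.atTop, 0 ≤ logSumDeriv m y ∧ logSumDeriv m y ≤ m / y := by
  have : ∀ᶠ y in Filter.atTop, ∀ i ∈ Finset.range m, Real.exp (-logSum (i + 1) y) ≤ 1 / y :=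
    (Filter.eventually_all_finset _).2 fun j _ => eventually_exp_neg_logSum_le (by omega)
  filter_upwards [this] with y hy
  refine ⟨Finset.sum_nonneg fun i _ => (Real.exp_pos _).le, (Finset.sum_le_sum hy).trans ?_⟩
  simp [div_eq_mul_inv]

theorem eventually_abs_logSumDeriv₂_le (m : ℕ) :
    ∀ᶠ y in Filter.atTop, |logSumDeriv₂ m y| ≤ m * m / y ^ 2 := by
  have : ∀ᶠ y in Filter.atTop, ∀ i ∈ Finset.range m, Real.exp (-logSum (i + 1) y) ≤ 1 / y ∧
      0 ≤ logSumDeriv (i + 1) y ∧ logSumDeriv (i + 1) y ≤ (i + 1 : ℕ) / y :=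
    (Filter.eventually_all_finset _).2 fun j _ => (eventually_exp_neg_logSum_le (by omega)).and
      (eventually_logSumDeriv_le (j + 1))
  filter_upwards [this, Filter.eventually_gt_atTop 0] with y hy h0
  refine (Finset.abs_sum_le_sum_abs _ _).trans ?_
  calc _ ≤ ∑ i ∈ Finset.range m, (m : ℝ) / y ^ 2 := Finset.sum_le_sum fun i hi => by
        obtain ⟨h1, h2, h3⟩ := hy i hi
        rw [abs_mul, abs_neg, abs_of_pos (Real.exp_pos _), abs_of_nonneg h2]
        calc _ ≤ 1 / y * ((m : ℕ) / y) := by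
              gcongr
              refine h3.trans ?_
              have : i + 1 ≤ m := Finset.mem_range.1 hi
              gcongr
          _ = _ := by field_simp
    _ = _ := by simp; ring

theorem eventually_iterLog_succ_le_log (j : ℕ) :
    ∀ᶠ y in Filter.atTop, iterLog (j + 1) y ≤ Real.log y := by
  induction j with
  | zero => exact Filter.Eventually.of_forall fun y => le_rfl
  | succ j ih =>
    filter_upwards [ih, eventually_iterLog_ge (j + 1) 1] with y hy h1
    exact (Real.log_le_self (by linarith)).trans hy

theorem eventually_logSum_le (m : ℕ) :
    ∀ᶠ y in Filter.atTop, 0 ≤ logSum m y ∧ logSum m y ≤ m * Real.log y := by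
  have : ∀ᶠ y in Filter.atTop, ∀ i ∈ Finset.range m, iterLog (i + 1) y ≤ Real.log y :=
    (Filter.eventually_all_finset _).2 fun j _ => eventually_iterLog_succ_le_log j
  filter_upwards [this, eventually_iterLog_pos (m + 1)] with y hy hpos
  refine ⟨Finset.sum_nonneg fun i hi => ?_, (Finset.sum_le_sum hy).trans (by simp)⟩
  have := hpos (i + 1) (by simpa using hi)
  linarith

open Filter Topology Asymptotics in
theorem logProd_isLittleO (m : ℕ) : logProd m =o[atTop] fun y : ℝ => y ^ 2 := by
  have hlog : ∀ j : ℕ, (fun y : ℝ => logProd (j + 1) y) =O[atTop]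
      fun y => y * Real.log y ^ j := by
    intro j
    induction j with
    | zero => simpa [logProd, iterLog] using isBigO_refl _ _
    | succ j ih =>
      have : (iterLog (j + 1)) =O[atTop] Real.log := by
        refine IsBigO.of_bound 1 ?_
        filter_upwards [eventually_iterLog_succ_le_log j, eventually_iterLog_ge (j + 1) 0]
          with y h1 h2
        rw [one_mul, Real.norm_of_nonneg h2, Real.norm_of_nonneg (h2.trans h1)]
        exact h1
      have h := ih.mul this
      refine (h.congr_left fun y => ?_).congr_right fun y => ?_
      · rw [logProd, logProd, Finset.prod_range_succ _ (j + 1)]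
      · ring
  cases m with
  | zero =>
    have : (fun _ : ℝ => (1 : ℝ)) =o[atTop] fun y : ℝ => y ^ 2 :=
      isLittleO_const_left.2 (Or.inr (tendsto_norm_atTop_atTop.comp (tendsto_pow_atTop two_ne_zero)))
    exact this.congr_left fun y => by simp [logProd]
  | succ j =>
    refine (hlog j).trans_isLittleO ?_
    have := (isBigO_refl (fun y : ℝ => y) atTop).mul_isLittleO
      (Real.isLittleO_pow_log_id_atTop (n := j))
    exact this.congr_right fun y => by simp [pow_two]

/-- The value of `G_m` along the approximate solution. -/
noncomputable def shiftedTime (m : ℕ) (k t : ℝ) : ℝ :=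
  2 * t + (Real.log (2 * k) - logSum m (2 * t))

theorem tendsto_two_mul_atTop : Filter.Tendsto (fun t : ℝ => 2 * t) Filter.atTop Filter.atTop :=
  Filter.tendsto_id.const_mul_atTop two_pos

theorem eventually_abs_shift_le (m : ℕ) (k : ℝ) :
    ∀ᶠ t in Filter.atTop, |Real.log (2 * k) - logSum m (2 * t)| ≤ (2 * m + 1) * Real.log t := by
  filter_upwards [tendsto_two_mul_atTop.eventually (eventually_logSum_le m),
    Filter.eventually_ge_atTop 2,
    Real.tendsto_log_atTop.eventually_ge_atTop |Real.log (2 * k)|] with t h1 h2 h3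
  have h4 : Real.log (2 * t) ≤ 2 * Real.log t := by
    rw [Real.log_mul (by norm_num) (by linarith)]
    have := Real.log_le_log (by norm_num) h2
    linarith
  have h5 : (m : ℝ) * Real.log (2 * t) ≤ m * (2 * Real.log t) := by gcongr
  refine (abs_sub _ _).trans ?_
  rw [abs_of_nonneg h1.1]
  linarith [h1.2]

theorem eventually_shiftedTime_mem (m : ℕ) (k : ℝ) :
    ∀ᶠ t in Filter.atTop, t ≤ shiftedTime m k t ∧ shiftedTime m k t ≤ 3 * t := by
  have hlog := (Real.isLittleO_log_id_atTop).bound (c := 1 / (2 * m + 1)) (by positivity)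
  filter_upwards [eventually_abs_shift_le m k, hlog, Filter.eventually_ge_atTop 1] with t h1 h2 h3
  rw [Real.norm_of_nonneg (Real.log_nonneg h3), id, Real.norm_of_nonneg (by linarith)] at h2
  have h4 : (2 * m + 1) * Real.log t ≤ t := by
    have := mul_le_mul_of_nonneg_left h2 (by positivity : (0 : ℝ) ≤ 2 * m + 1)
    rwa [← mul_assoc, mul_one_div_cancel (by positivity), one_mul] at this
  have h5 := abs_le.1 (h1.trans h4)
  constructor <;> rw [shiftedTime] <;> linarith [h5.1, h5.2]

theorem tendsto_shiftedTime (m : ℕ) (k : ℝ) :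
    Filter.Tendsto (shiftedTime m k) Filter.atTop Filter.atTop :=
  Filter.tendsto_atTop_mono' _ ((eventually_shiftedTime_mem m k).mono fun _ h => h.1)
    Filter.tendsto_id

/-- The derivative of `shiftedTime`. -/
noncomputable def shiftedTimeDeriv (m : ℕ) (t : ℝ) : ℝ := 2 - 2 * logSumDeriv m (2 * t)

/-- The approximate solution. -/
noncomputable def approx (m : ℕ) (k t : ℝ) : ℝ := iterLog m (shiftedTime m k t)

/-- The derivative of the approximate solution. -/
noncomputable def approxDeriv (m : ℕ) (k t : ℝ) : ℝ :=
  Real.exp (-logSum m (shiftedTime m k t)) * shiftedTimeDeriv m t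

/-- The second derivative of the approximate solution. -/
noncomputable def approxDeriv₂ (m : ℕ) (k t : ℝ) : ℝ :=
  Real.exp (-logSum m (shiftedTime m k t)) *
      -(logSumDeriv m (shiftedTime m k t) * shiftedTimeDeriv m t) * shiftedTimeDeriv m t +
    Real.exp (-logSum m (shiftedTime m k t)) * -(2 * (logSumDeriv₂ m (2 * t) * 2))

theorem eventually_hasDerivAt_shiftedTime (m : ℕ) (k : ℝ) :
    ∀ᶠ t in Filter.atTop, HasDerivAt (shiftedTime m k) (shiftedTimeDeriv m t) t := by
  filter_upwards [tendsto_two_mul_atTop.eventually (eventually_hasDerivAt_logSum m)] with t h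
  have h2 : HasDerivAt (fun t : ℝ => 2 * t) 2 t := by simpa using (hasDerivAt_id t).const_mul 2
  refine (h2.add ((h.comp t h2).const_sub _)).congr_deriv ?_
  rw [shiftedTimeDeriv]
  ring

theorem eventually_hasDerivAt_shiftedTimeDeriv (m : ℕ) :
    ∀ᶠ t in Filter.atTop, HasDerivAt (shiftedTimeDeriv m) (-(2 * (logSumDeriv₂ m (2 * t) * 2))) t := by
  filter_upwards [tendsto_two_mul_atTop.eventually (eventually_hasDerivAt_logSumDeriv m)] with t h
  have h2 : HasDerivAt (fun t : ℝ => 2 * t) 2 t := by simpa using (hasDerivAt_id t).const_mul 2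
  exact ((h.comp t h2).const_mul 2).const_sub 2

theorem eventually_hasDerivAt_approx (m : ℕ) (k : ℝ) :
    ∀ᶠ t in Filter.atTop, HasDerivAt (approx m k) (approxDeriv m k t) t ∧
      HasDerivAt (approxDeriv m k) (approxDeriv₂ m k t) t ∧ ContinuousAt (approxDeriv₂ m k) t := by
  have hT := tendsto_shiftedTime m k
  filter_upwards [hT.eventually (eventually_hasDerivAt_iterLog m),
    hT.eventually (eventually_hasDerivAt_logSum m),
    hT.eventually (eventually_hasDerivAt_logSumDeriv m),
    tendsto_two_mul_atTop.eventually (eventually_continuousAt_logSumDeriv₂ m),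
    eventually_hasDerivAt_shiftedTime m k, eventually_hasDerivAt_shiftedTimeDeriv m]
    with t h1 h2 h3 h4 h5 h6
  have hE := ((h2.comp t h5).neg).exp
  have hc4 : ContinuousAt (fun t : ℝ => logSumDeriv₂ m (2 * t)) t :=
    ContinuousAt.comp (f := fun t : ℝ => 2 * t) h4 (by fun_prop)
  have hc3 : ContinuousAt (fun t : ℝ => logSumDeriv m (shiftedTime m k t)) t :=
    h3.continuousAt.comp h5.continuousAt
  refine ⟨h1.comp t h5, hE.mul h6, ?_⟩
  exact ((hE.continuousAt.mul ((hc3.mul h6.continuousAt).neg)).mul h6.continuousAt).add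
    (hE.continuousAt.mul (((hc4.mul continuousAt_const).const_mul 2).neg))

theorem eventually_abs_approxDeriv₂_le {m : ℕ} (hm : 2 ≤ m) (k : ℝ) :
    ∀ᶠ t in Filter.atTop,
      |approxDeriv₂ m k t| ≤ (m * (2 + 2 * m) ^ 2 + 4 * (m * m)) / t ^ 2 := by
  have hT := tendsto_shiftedTime m k
  filter_upwards [hT.eventually (eventually_exp_neg_logSum_le (m := m) (by omega)),
    hT.eventually (eventually_logSumDeriv_le m),
    tendsto_two_mul_atTop.eventually (eventually_logSumDeriv_le m),
    tendsto_two_mul_atTop.eventually (eventually_abs_logSumDeriv₂_le m),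
    eventually_shiftedTime_mem m k, Filter.eventually_ge_atTop 1] with t h1 h2 h3 h4 h5 h6
  have ht : 0 < t := by linarith
  have hy : 0 < shiftedTime m k t := by linarith
  have hh : Real.exp (-logSum m (shiftedTime m k t)) ≤ 1 / t :=
    h1.trans (one_div_le_one_div_of_le ht h5.1)
  have hh1 : Real.exp (-logSum m (shiftedTime m k t)) ≤ 1 :=
    hh.trans (by rw [div_le_one ht]; exact h6)
  have hs : logSumDeriv m (shiftedTime m k t) ≤ m / t :=
    h2.2.trans (div_le_div_of_nonneg_left (by positivity) ht h5.1)
  have hd : |shiftedTimeDeriv m t| ≤ 2 + 2 * m := by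
    have : (m : ℝ) / (2 * t) ≤ m := div_le_self (by positivity) (by linarith)
    rw [shiftedTimeDeriv, abs_le]
    constructor <;> linarith [h3.1, h3.2]
  have h4' : |logSumDeriv₂ m (2 * t)| ≤ m * m / t ^ 2 :=
    h4.trans (div_le_div_of_nonneg_left (by positivity) (by positivity) (by nlinarith))
  rw [approxDeriv₂]
  refine (abs_add_le _ _).trans ?_
  simp only [abs_mul, abs_neg, abs_of_pos (Real.exp_pos _), abs_of_nonneg h2.1, abs_two]
  calc _ ≤ 1 / t * (m / t * (2 + 2 * m)) * (2 + 2 * m) + 1 * (2 * (m * m / t ^ 2 * 2)) := by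
        gcongr
        exact mul_nonneg h2.1 (abs_nonneg _)
    _ = _ := by field_simp; ring

theorem eventually_abs_approxDeriv_sub_le {m : ℕ} (hm : 2 ≤ m) (k : ℝ) :
    ∀ᶠ t in Filter.atTop, |approxDeriv m k t - 2 * Real.exp (-logSum m (2 * t))|
      ≤ (2 * m + 2 * (m * (2 * m + 1))) / t ^ 2 := by
  have hT := tendsto_shiftedTime m k
  have hev := ((eventually_hasDerivAt_logSum m).and (eventually_logSumDeriv_le m)).and
    (eventually_exp_neg_logSum_le_log hm)
  obtain ⟨N, hN⟩ := Filter.eventually_atTop.1 hev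
  filter_upwards [hT.eventually (eventually_exp_neg_logSum_le (m := m) (by omega)),
    tendsto_two_mul_atTop.eventually (eventually_logSumDeriv_le m), eventually_abs_shift_le m k,
    eventually_shiftedTime_mem m k, Filter.eventually_gt_atTop 1, Filter.eventually_ge_atTop N]
    with t h1 h3 h4 h5 h6 h7
  have ht : 0 < t := by linarith
  have hl : 0 < Real.log t := Real.log_pos h6
  have hh : Real.exp (-logSum m (shiftedTime m k t)) ≤ 1 / t :=
    h1.trans (one_div_le_one_div_of_le ht h5.1)
  have hs : logSumDeriv m (2 * t) ≤ m / t :=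
    h3.2.trans (div_le_div_of_nonneg_left (by positivity) ht (by linarith))
  have hmv := Convex.norm_image_sub_le_of_norm_hasDerivWithin_le (s := Set.Ici t)
    (f := fun y => Real.exp (-logSum m y))
    (f' := fun y => Real.exp (-logSum m y) * -logSumDeriv m y) (C := m / (t ^ 2 * Real.log t))
    (x := 2 * t) (y := shiftedTime m k t)
    (fun y hy => (hN y (h7.trans hy)).1.1.neg.exp.hasDerivWithinAt)
    (fun y hy => by
      obtain ⟨⟨-, g1, g2⟩, g3⟩ := hN y (h7.trans hy)
      have hy' : t ≤ y := hy
      have hy0 : 0 ≤ y := by linarith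
      rw [Real.norm_eq_abs, abs_mul, abs_neg, abs_of_pos (Real.exp_pos _), abs_of_nonneg g1]
      calc _ ≤ 1 / (t * Real.log t) * (m / t) := by
            gcongr
            · refine g3.trans (one_div_le_one_div_of_le (by positivity) ?_)
              gcongr
            · exact g2.trans (div_le_div_of_nonneg_left (by positivity) ht hy')
        _ = _ := by field_simp)
    (convex_Ici t) (by simp only [Set.mem_Ici]; linarith) h5.1
  rw [Real.norm_eq_abs, Real.norm_eq_abs,
    show shiftedTime m k t - 2 * t = Real.log (2 * k) - logSum m (2 * t) by
      rw [shiftedTime]; ring] at hmv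
  have hmv' : |Real.exp (-logSum m (shiftedTime m k t)) - Real.exp (-logSum m (2 * t))|
      ≤ m * (2 * m + 1) / t ^ 2 := by
    refine hmv.trans ((mul_le_mul_of_nonneg_left h4 (by positivity)).trans (le_of_eq ?_))
    field_simp
  rw [approxDeriv, shiftedTimeDeriv]
  set p := Real.exp (-logSum m (shiftedTime m k t))
  set q := Real.exp (-logSum m (2 * t))
  have hp : 0 < p := Real.exp_pos _
  calc |p * (2 - 2 * logSumDeriv m (2 * t)) - 2 * q|
      = |-(2 * (p * logSumDeriv m (2 * t))) + 2 * (p - q)| := by congr 1; ring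
    _ ≤ 2 * (p * logSumDeriv m (2 * t)) + 2 * |p - q| := by
        refine (abs_add_le _ _).trans (le_of_eq ?_)
        rw [abs_neg, abs_of_nonneg (by have := h3.1; positivity), abs_mul, abs_two]
    _ ≤ 2 * (1 / t * (m / t)) + 2 * (m * (2 * m + 1) / t ^ 2) := by
        gcongr
        exact h3.1
    _ = _ := by field_simp

open Filter Topology Asymptotics in
theorem tendsto_logProd_div (m : ℕ) (k : ℝ) :
    Tendsto (fun t => logProd m (shiftedTime m k t) * (logProd m (2 * t))⁻¹) atTop (𝓝 1) := by
  have h0 : shiftedTime m k ~[atTop] fun t => 2 * t := by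
    have : (fun t => Real.log (2 * k) - logSum m (2 * t)) =O[atTop] Real.log :=
      IsBigO.of_bound (2 * m + 1) <| by
        filter_upwards [eventually_abs_shift_le m k, eventually_ge_atTop 1] with t h h1
        rwa [Real.norm_eq_abs, Real.norm_of_nonneg (Real.log_nonneg h1)]
    have h2 := (this.trans_isLittleO Real.isLittleO_log_id_atTop).const_mul_right'
      (isUnit_iff_ne_zero.2 (two_ne_zero (α := ℝ)))
    exact h2.congr_left fun t => by simp [shiftedTime]
  have hi : ∀ i : ℕ, (fun t => iterLog i (shiftedTime m k t)) ~[atTop] fun t => iterLog i (2 * t) := by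
    intro i
    induction i with
    | zero => exact h0
    | succ i ih => exact ih.log ((tendsto_iterLog i).comp tendsto_two_mul_atTop)
  have hp : (fun t => logProd m (shiftedTime m k t)) ~[atTop] fun t => logProd m (2 * t) := by
    have : ∀ j : ℕ, (fun t => logProd j (shiftedTime m k t)) ~[atTop] fun t => logProd j (2 * t) := by
      intro j
      induction j with
      | zero => simpa [logProd] using! IsEquivalent.refl
      | succ j ih => simpa only [logProd, Finset.prod_range_succ] using! ih.mul (hi j)
    exact this m
  refine (isEquivalent_iff_tendsto_one ?_).1 hp
  filter_upwards [tendsto_two_mul_atTop.eventually (eventually_exp_logSum m)] with t ht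
  rw [← ht]
  exact (Real.exp_pos _).ne'

open Filter Topology Asymptotics in
theorem tendsto_linearization {α : Type*} {l : Filter α} {t z : α → ℝ} (m : ℕ) {k B : ℝ}
    (hk : 0 < k) (ht : Tendsto t l atTop) (hz : ∀ᶠ a in l, |z a| ≤ B / t a ^ 2) :
    Tendsto (fun a => Real.exp (-2 * t a + iterExp m (approx m k (t a) + z a)) *
      iterExpDeriv m (approx m k (t a) + z a)) l (𝓝 (2 * k)) := by
  set y : α → ℝ := fun a => shiftedTime m k (t a) with hy
  have hyT : Tendsto y l atTop := (tendsto_shiftedTime m k).comp ht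
  set X : α → ℝ := fun a => approx m k (t a) with hX
  have hinv : ∀ᶠ a in l, iterExp m (X a) = y a ∧ iterExpDeriv m (X a) = logProd m (y a) :=
    hyT.eventually (eventually_iterExp_iterLog m)
  have hX0 : ∀ᶠ a in l, 0 ≤ X a := hyT.eventually (eventually_iterLog_ge m 0)
  have hQz : Tendsto (fun a => iterExpDeriv m (X a) * z a) l (𝓝 0) := by
    have hzO : z =O[l] fun a => (t a ^ 2)⁻¹ := by
      refine IsBigO.of_bound B ?_
      filter_upwards [hz] with a ha
      rwa [Real.norm_eq_abs, norm_inv, Real.norm_of_nonneg (sq_nonneg _), ← div_eq_mul_inv]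
    have hyO : (fun a => y a ^ 2) =O[l] fun a => t a ^ 2 := by
      refine IsBigO.pow (IsBigO.of_bound 3 ?_) 2
      filter_upwards [ht.eventually (eventually_shiftedTime_mem m k), ht.eventually_ge_atTop 0]
        with a ha h0
      rw [Real.norm_of_nonneg (h0.trans ha.1), Real.norm_of_nonneg h0]
      exact ha.2
    have hL : (fun a => logProd m (y a)) =o[l] fun a => t a ^ 2 :=
      ((logProd_isLittleO m).comp_tendsto hyT).trans_isBigO hyO
    have h := hL.mul_isBigO hzO
    have h1 : (fun a => logProd m (y a) * z a) =o[l] fun _ => (1 : ℝ) := by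
      refine h.congr' EventuallyEq.rfl ?_
      filter_upwards [ht.eventually_gt_atTop 0] with a ha
      exact mul_inv_cancel₀ (by positivity)
    refine ((isLittleO_one_iff ℝ).1 h1).congr' ?_
    filter_upwards [hinv] with a ha
    rw [ha.2]
  have hQpos : ∀ j a, 0 < iterExpDeriv j (X a) := fun j a =>
    Finset.prod_pos fun i _ => Real.exp_pos _
  have hQj : ∀ j, j ≤ m → Tendsto (fun a => iterExpDeriv j (X a) * z a) l (𝓝 0) := by
    intro j hj
    refine squeeze_zero_norm' ?_ (tendsto_zero_iff_norm_tendsto_zero.1 hQz)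
    filter_upwards [hX0] with a ha
    rw [norm_mul, norm_mul, Real.norm_of_nonneg (hQpos _ _).le, Real.norm_of_nonneg (hQpos _ _).le]
    refine mul_le_mul_of_nonneg_right ?_ (norm_nonneg _)
    refine monotone_nat_of_le_succ (f := fun j => iterExpDeriv j (X a)) (fun i => ?_) hj
    change _ ≤ ∏ i ∈ Finset.range (i + 1), _
    rw [Finset.prod_range_succ]
    exact le_mul_of_one_le_right (hQpos i a).le (Real.one_le_exp (iterExp_nonneg i ha))
  set D : ℕ → α → ℝ := fun j a => iterExp j (X a + z a) - iterExp j (X a) with hD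
  have hDstep : ∀ j a, iterExp (j + 1) (X a + z a) = iterExp (j + 1) (X a) * Real.exp (D j a) := by
    intro j a
    change Real.exp _ = Real.exp _ * _
    rw [← Real.exp_add, hD]
    simp
  have hDlim : ∀ j, j ≤ m → D j =O[l] (fun a => iterExpDeriv j (X a) * z a) ∧
      Tendsto (D j) l (𝓝 0) := by
    intro j
    induction j with
    | zero =>
      intro h
      have : D 0 =O[l] (fun a => iterExpDeriv 0 (X a) * z a) := by
        simpa [hD, iterExp, iterExpDeriv] using! isBigO_refl z l
      exact ⟨this, this.trans_tendsto (hQj 0 h)⟩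
    | succ j ih =>
      intro h
      obtain ⟨h1, h2⟩ := ih (by omega)
      have hexp : (fun a => Real.exp (D j a) - 1) =O[l] D j := by
        refine IsBigO.of_bound 2 ?_
        filter_upwards [(tendsto_zero_iff_norm_tendsto_zero.1 h2).eventually_le_const one_pos]
          with a ha
        exact Real.abs_exp_sub_one_le ha
      have h3 : D (j + 1) =O[l] (fun a => iterExpDeriv (j + 1) (X a) * z a) := by
        refine ((isBigO_refl (fun a => iterExp (j + 1) (X a)) l).mul (hexp.trans h1)).congr
          (fun a => ?_) (fun a => ?_)
        · change _ = iterExp (j + 1) (X a + z a) - _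
          rw [hDstep]
          ring
        · rw [iterExpDeriv, iterExpDeriv, Finset.prod_range_succ]
          ring
      exact ⟨h3, h3.trans_tendsto (hQj _ h)⟩
  have hDexp : ∀ j, j ≤ m → Tendsto (fun a => Real.exp (D j a)) l (𝓝 1) := fun j hj => by
    simpa using (hDlim j hj).2.rexp
  have hprod : Tendsto (fun a => ∏ i ∈ Finset.range m, Real.exp (D i a)) l (𝓝 1) := by
    simpa using tendsto_finsetProd (Finset.range m)
      (fun i hi => hDexp i (Finset.mem_range.1 hi).le)
  have hlim := ((((tendsto_logProd_div m k).comp ht).mul (hDexp m le_rfl)).mul hprod).const_mul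
    (2 * k)
  simp only [mul_one] at hlim
  refine hlim.congr' ?_
  filter_upwards [hinv, (tendsto_two_mul_atTop.comp ht).eventually (eventually_exp_logSum m)]
    with a ha h2
  have e1 : iterExpDeriv m (X a + z a)
      = logProd m (y a) * ∏ i ∈ Finset.range m, Real.exp (D i a) := by
    rw [← ha.2, iterExpDeriv, iterExpDeriv, ← Finset.prod_mul_distrib]
    exact Finset.prod_congr rfl fun i _ => hDstep i a
  have e2 : Real.exp (-2 * t a + iterExp m (X a + z a))
      = 2 * k * (logProd m (2 * t a))⁻¹ * Real.exp (D m a) := by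
    have : -2 * t a + iterExp m (X a + z a)
        = Real.log (2 * k) + -logSum m (2 * t a) + D m a := by
      simp only [hD, ha.1, hy, shiftedTime]
      ring
    rw [this, Real.exp_add, Real.exp_add, Real.exp_log (by positivity), Real.exp_neg]
    congr 3
  simp only [Function.comp]
  change _ = Real.exp (-2 * t a + iterExp m (X a + z a)) * iterExpDeriv m (X a + z a)
  rw [e1, e2]
  ring

open Filter Topology in
theorem eventually_linearization_le (m : ℕ) {k ε : ℝ} (B : ℝ) (hk : 0 < k) (hε : 0 < ε) :
    ∀ᶠ t in atTop, ∀ z : ℝ, |z| ≤ B / t ^ 2 →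
      |Real.exp (-2 * t + iterExp m (approx m k t + z)) * iterExpDeriv m (approx m k t + z) - 2 * k|
        ≤ ε := by
  set l : Filter (ℝ × ℝ) := comap Prod.fst atTop ⊓ 𝓟 {p | |p.2| ≤ B / p.1 ^ 2} with hl
  have h := tendsto_linearization (l := l) (t := Prod.fst) (z := Prod.snd) m (B := B) hk
    (tendsto_comap.mono_left inf_le_left)
    (Eventually.filter_mono inf_le_right (mem_principal_self _))
  have h2 := (Metric.tendsto_nhds.1 h) ε hε
  rw [hl, eventually_inf_principal, eventually_comap] at h2
  filter_upwards [h2] with t ht z hz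
  exact (ht (t, z) rfl hz).le

theorem abs_clamp_sub_clamp_le (γ β x y : ℝ) :
    |max γ (min x β) - max γ (min y β)| ≤ |x - y| := by
  rw [max_comm, max_comm γ]
  exact (abs_sup_sub_sup_le_abs _ _ _).trans (abs_inf_sub_inf_le_abs _ _ _)

theorem abs_clamp_le {β : ℝ} (hβ : 0 ≤ β) (x : ℝ) : |max (-β) (min x β)| ≤ β :=
  abs_le.2 ⟨le_max_left _ _, max_le (by linarith) (min_le_right _ _)⟩

theorem clamp_eq {β x : ℝ} (h : |x| ≤ β) : max (-β) (min x β) = x := by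
  rw [min_eq_left (abs_le.1 h).2, max_eq_right (abs_le.1 h).1]

open Filter in
theorem eventually_lt_exp_neg_logSum (m : ℕ) {c : ℝ} (hc : 0 < c) :
    ∀ᶠ t in atTop, c / t ^ 2 < 2 * Real.exp (-logSum m (2 * t)) := by
  have h := tendsto_two_mul_atTop.eventually
    ((logProd_isLittleO m).bound (c := 1 / (4 * c)) (by positivity))
  filter_upwards [h, tendsto_two_mul_atTop.eventually (eventually_exp_logSum m),
    eventually_gt_atTop 0] with t h1 h2 h3
  rw [← h2, Real.norm_of_nonneg (Real.exp_pos _).le, Real.norm_of_nonneg (by positivity)] at h1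
  have h4 : Real.exp (logSum m (2 * t)) ≤ t ^ 2 / c := h1.trans (le_of_eq (by field_simp; ring))
  have h5 : c / t ^ 2 ≤ Real.exp (-logSum m (2 * t)) := by
    rw [Real.exp_neg, ← inv_div]
    exact inv_anti₀ (Real.exp_pos _) h4
  linarith [Real.exp_pos (-logSum m (2 * t))]

open Filter in
/-- Existence of the singular solution near infinity. -/
theorem exists_solution_near_infinity {m : ℕ} (hm : 2 ≤ m) {k : ℝ} (hk : 0 < k) :
    ∃ T > (0 : ℝ), ∃ C > (0 : ℝ), ∃ w v : ℝ → ℝ, ∀ t, T ≤ t →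
      HasDerivAt w (v t) t ∧ HasDerivAt v (k * v t - Real.exp (-2 * t + iterExp m (w t))) t ∧
      0 < w t ∧ 0 < v t ∧ |w t - approx m k t| ≤ C / t ^ 2 ∧
      |v t - 2 * Real.exp (-logSum m (2 * t))| ≤ C / t ^ 2 := by
  obtain ⟨c, hc, hsol⟩ := exists_bounded_solution hk
  set A₁ : ℝ := m * (2 + 2 * m) ^ 2 + 4 * (m * m) with hA₁
  set A₂ : ℝ := 2 * m + 2 * (m * (2 * m + 1)) with hA₂
  have hm0 : (0 : ℝ) < m := by exact_mod_cast (by omega : 0 < m)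
  have hA₁pos : 0 < A₁ := by positivity
  have hA₂pos : 0 < A₂ := by positivity
  set A := A₁ + k * A₂ with hA
  set B := 2 * A / c with hB
  have hApos : 0 < A := by positivity
  have hBpos : 0 < B := by positivity
  have hcB : c * B = 2 * A := by rw [hB]; field_simp
  have hev : ∀ᶠ t in atTop, (HasDerivAt (approx m k) (approxDeriv m k t) t ∧
      HasDerivAt (approxDeriv m k) (approxDeriv₂ m k t) t ∧ ContinuousAt (approxDeriv₂ m k) t) ∧
      |approxDeriv₂ m k t| ≤ A₁ / t ^ 2 ∧
      |approxDeriv m k t - 2 * Real.exp (-logSum m (2 * t))| ≤ A₂ / t ^ 2 ∧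
      (∀ z : ℝ, |z| ≤ B / t ^ 2 → |Real.exp (-2 * t + iterExp m (approx m k t + z)) *
        iterExpDeriv m (approx m k t + z) - 2 * k| ≤ c / 2) ∧
      iterExp m (approx m k t) = shiftedTime m k t ∧ B + 1 ≤ approx m k t ∧
      (A₂ + B) / t ^ 2 < 2 * Real.exp (-logSum m (2 * t)) := by
    filter_upwards [eventually_hasDerivAt_approx m k, eventually_abs_approxDeriv₂_le hm k,
      eventually_abs_approxDeriv_sub_le hm k, eventually_linearization_le m B hk (half_pos hc),
      (tendsto_shiftedTime m k).eventually (eventually_iterExp_iterLog m),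
      (tendsto_shiftedTime m k).eventually (eventually_iterLog_ge m (B + 1)),
      eventually_lt_exp_neg_logSum m (add_pos hA₂pos hBpos)] with t h1 h2 h3 h4 h5 h6 h7
    exact ⟨h1, h2, h3, h4, h5.1, h6, h7⟩
  obtain ⟨N, hN⟩ := eventually_atTop.1 hev
  set T := max N 1 with hT
  have hT1 : 1 ≤ T := le_max_right _ _
  set ρ : ℝ → ℝ := fun t => max t T with hρ
  have hρc : Continuous ρ := by fun_prop
  have hρT : ∀ t, T ≤ ρ t := fun t => le_max_right _ _
  have hρ1 : ∀ t, 1 ≤ ρ t := fun t => hT1.trans (hρT t)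
  have hρ0 : ∀ t, 0 < ρ t := fun t => by linarith [hρ1 t]
  have hρN : ∀ t, N ≤ ρ t := fun t => (le_max_left _ _).trans (hρT t)
  set S : ℝ → ℝ → ℝ := fun s z => 2 * k * z - Real.exp (-2 * s + iterExp m (approx m k s + z))
    - approxDeriv₂ m k s + k * approxDeriv m k s with hS
  set β : ℝ → ℝ := fun t => B / ρ t ^ 2 with hβ
  have hβ0 : ∀ t, 0 ≤ β t := fun t => by have := hρ0 t; positivity
  have hβc : Continuous β := continuous_const.div (hρc.pow 2) fun t => (pow_pos (hρ0 t) 2).ne'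
  set R : ℝ → ℝ → ℝ := fun t z => S (ρ t) (max (-β t) (min z (β t))) with hR
  have hlip : ∀ t z₁ z₂, |z₁| ≤ β t → |z₂| ≤ β t →
      |S (ρ t) z₁ - S (ρ t) z₂| ≤ c / 2 * |z₁ - z₂| := by
    intro t z₁ z₂ h1 h2
    obtain ⟨-, -, -, hlin, -⟩ := hN (ρ t) (hρN t)
    refine Convex.norm_image_sub_le_of_norm_hasDerivWithin_le (s := Set.Icc (-β t) (β t))
      (f := S (ρ t)) (f' := fun z => 2 * k - Real.exp (-2 * ρ t + iterExp m (approx m k (ρ t) + z)) *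
        iterExpDeriv m (approx m k (ρ t) + z)) (fun z _ => ?_) (fun z hz => ?_)
      (convex_Icc _ _) (abs_le.1 h2) (abs_le.1 h1)
    · refine HasDerivAt.hasDerivWithinAt ?_
      have h3 : HasDerivAt (fun z => iterExp m (approx m k (ρ t) + z))
          (iterExpDeriv m (approx m k (ρ t) + z)) z :=
        ((hasDerivAt_iterExp m (approx m k (ρ t) + z)).comp_const_add _ _)
      have h4 := ((((hasDerivAt_id z).const_mul (2 * k)).sub
        ((h3.const_add (-2 * ρ t)).exp)).sub_const (approxDeriv₂ m k (ρ t))).add_const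
          (k * approxDeriv m k (ρ t))
      exact h4.congr_deriv (by ring)
    · rw [Real.norm_eq_abs, abs_sub_comm]
      exact hlin z (abs_le.2 hz)
  have hS0 : ∀ t, |S (ρ t) 0| ≤ A / ρ t ^ 2 := by
    intro t
    obtain ⟨-, h2, h3, -, h5, -⟩ := hN (ρ t) (hρN t)
    have he : Real.exp (-2 * ρ t + iterExp m (approx m k (ρ t) + 0))
        = 2 * k * Real.exp (-logSum m (2 * ρ t)) := by
      rw [add_zero, h5, shiftedTime, ← Real.exp_log (by positivity : 0 < 2 * k), ← Real.exp_add,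
        Real.exp_log (by positivity : 0 < 2 * k)]
      congr 1
      ring
    simp only [hS]
    rw [he]
    calc _ = |-approxDeriv₂ m k (ρ t)
          + k * (approxDeriv m k (ρ t) - 2 * Real.exp (-logSum m (2 * ρ t)))| := by
          congr 1; ring
      _ ≤ A₁ / ρ t ^ 2 + k * (A₂ / ρ t ^ 2) := by
          refine (abs_add_le _ _).trans ?_
          rw [abs_neg, abs_mul, abs_of_pos hk]
          gcongr
      _ = _ := by rw [hA]; ring
  have hcont : ∀ {f : ℝ → ℝ}, (∀ s, N ≤ s → ContinuousAt f s) → Continuous fun t => f (ρ t) :=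
    fun hf => continuous_iff_continuousAt.2 fun t =>
      ContinuousAt.comp (hf _ (hρN t)) hρc.continuousAt
  have hc0 := hcont fun s hs => (hN s hs).1.1.continuousAt
  have hc1 := hcont fun s hs => (hN s hs).1.2.1.continuousAt
  have hc2 := hcont fun s hs => (hN s hs).1.2.2
  have hG := (contDiff_iterExp m).continuous
  obtain ⟨z, u, hzu⟩ := hsol R (fun t => c * β t) (c * B) (by
      have : Continuous fun p : ℝ × ℝ => max (-β p.1) (min p.2 (β p.1)) := by fun_prop
      exact (((continuous_const.mul this).sub (Real.continuous_exp.comp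
        ((continuous_const.mul (hρc.comp continuous_fst)).add
          (hG.comp ((hc0.comp continuous_fst).add this))))).sub (hc2.comp continuous_fst)).add
            (continuous_const.mul (hc1.comp continuous_fst)))
    (fun s t hst => by
      have : ρ s ≤ ρ t := max_le_max hst le_rfl
      have h0 := hρ0 s
      simp only [hβ]
      gcongr)
    (fun t => by
      refine mul_le_mul_of_nonneg_left (div_le_self hBpos.le ?_) hc.le
      exact one_le_pow₀ (hρ1 t))
    (fun t x => by
      have h1 := hlip t _ 0 (abs_clamp_le (hβ0 t) x) (by simpa using hβ0 t)
      have h2 := hS0 t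
      have h3 : A / ρ t ^ 2 = c / 2 * β t := by
        simp only [hβ]
        rw [← mul_div_assoc, div_mul_eq_mul_div, hcB]
        ring
      rw [sub_zero] at h1
      have h4 : c / 2 * |max (-β t) (min x (β t))| ≤ c / 2 * β t := by
        gcongr
        exact abs_clamp_le (hβ0 t) x
      have h5 : |R t x| ≤ |R t x - S (ρ t) 0| + |S (ρ t) 0| := by
        simpa using abs_add_le (R t x - S (ρ t) 0) (S (ρ t) 0)
      have h6 : |R t x - S (ρ t) 0| ≤ c / 2 * |max (-β t) (min x (β t))| := h1
      change |R t x| ≤ c * β t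
      linarith)
    (fun t x y => by
      refine (hlip t _ _ (abs_clamp_le (hβ0 t) x) (abs_clamp_le (hβ0 t) y)).trans ?_
      have h1 := abs_clamp_sub_clamp_le (-β t) (β t) x y
      have h2 : c / 2 * |max (-β t) (min x (β t)) - max (-β t) (min y (β t))|
        ≤ c / 2 * |x - y| := by gcongr
      have h3 : 0 ≤ c * |x - y| := by positivity
      linarith)
  refine ⟨T, by linarith, A₂ + B, by positivity, fun t => approx m k t + z t,
    fun t => approxDeriv m k t + u t, fun t ht => ?_⟩
  obtain ⟨hz, hu, hzb, hub⟩ := hzu t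
  have hρt : ρ t = t := max_eq_left ht
  have ht1 : 1 ≤ t := hT1.trans ht
  have ht0 : 0 < t := by linarith
  rw [mul_div_cancel_left₀ _ hc.ne'] at hzb hub
  have hβt : β t = B / t ^ 2 := by simp only [hβ, hρt]
  have hRt : R t (z t) = S t (z t) := by
    simp only [hR]
    rw [clamp_eq hzb, hρt]
  rw [hβt] at hzb hub
  rw [hRt] at hu
  obtain ⟨⟨h1, h1', -⟩, -, h3, -, -, h6, h7⟩ := hN t ((le_max_left _ _).trans ht)
  have hBt : B / t ^ 2 ≤ B := div_le_self hBpos.le (one_le_pow₀ ht1)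
  rw [add_div] at h7
  have h3' := abs_le.1 h3
  have hz' := abs_le.1 hzb
  have hu' := abs_le.1 hub
  have hAt : 0 < A₂ / t ^ 2 := by positivity
  refine ⟨h1.add hz, (h1'.add hu).congr_deriv ?_, by linarith, by linarith, ?_, ?_⟩
  · simp only [hS]
    ring
  · rw [add_sub_cancel_left, add_div]
    linarith
  · rw [add_div, abs_le]
    constructor <;> linarith

/-- Global existence on a compact interval for a bounded Lipschitz vector field. -/
theorem exists_hasDerivWithinAt_Icc_of_bounded {E : Type*} [NormedAddCommGroup E] [NormedSpace ℝ E]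
    [CompleteSpace E] {f : ℝ → E → E} {a b t₀ : ℝ} (ht₀ : t₀ ∈ Set.Icc a b) (L K : NNReal)
    (hlip : ∀ t ∈ Set.Icc a b, LipschitzWith K (f t))
    (hcont : ∀ x, ContinuousOn (fun t => f t x) (Set.Icc a b))
    (hbound : ∀ t ∈ Set.Icc a b, ∀ x, ‖f t x‖ ≤ L) (x₀ : E) :
    ∃ α : ℝ → E, α t₀ = x₀ ∧
      ∀ t ∈ Set.Icc a b, HasDerivWithinAt α (f t (α t)) (Set.Icc a b) t := by
  have hab : 0 ≤ b - a := by linarith [ht₀.1, ht₀.2]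
  have hpl : IsPicardLindelof f ⟨t₀, ht₀⟩ x₀ (L * ⟨b - a, hab⟩) 0 L K :=
    { lipschitzOnWith := fun t ht => (hlip t ht).lipschitzOnWith
      continuousOn := fun x _ => hcont x
      norm_le := fun t ht x _ => hbound t ht x
      mul_max_le := by
        simp only [NNReal.coe_zero, sub_zero]
        refine mul_le_mul_of_nonneg_left ?_ L.2
        exact max_le (by linarith [ht₀.1]) (by linarith [ht₀.2]) }
  exact hpl.exists_eq_forall_mem_Icc_hasDerivWithinAt₀

/-- A `C¹` function becomes globally Lipschitz after truncating its argument. -/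
theorem exists_lipschitz_clamp {g : ℝ → ℝ} (hg : ContDiff ℝ 1 g) {M : ℝ} (hM : 0 ≤ M) :
    ∃ K : NNReal, ∀ x y, |g (max 0 (min x M)) - g (max 0 (min y M))| ≤ K * |x - y| := by
  obtain ⟨K, hK⟩ := hg.contDiffOn.exists_lipschitzOnWith one_ne_zero (convex_Icc 0 M)
    isCompact_Icc
  refine ⟨K, fun x y => ?_⟩
  have h := hK.dist_le_mul (max 0 (min x M)) ⟨le_max_left _ _, max_le hM (min_le_right _ _)⟩
    (max 0 (min y M)) ⟨le_max_left _ _, max_le hM (min_le_right _ _)⟩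
  exact h.trans (mul_le_mul_of_nonneg_left (abs_clamp_sub_clamp_le 0 M x y) K.2)

/-- A planar system with truncated right-hand side is solvable on the whole interval. -/
theorem exists_truncated_solution {g A B : ℝ → ℝ} (hg : ContDiff ℝ 1 g) (hA : Continuous A)
    (hB : Continuous B) {a b : ℝ} (hab : a ≤ b) {M P : ℝ} (hM : 0 ≤ M) (hP : 0 ≤ P)
    (x₀ p₀ : ℝ) :
    ∃ w p : ℝ → ℝ, w b = x₀ ∧ p b = p₀ ∧ ∀ t ∈ Set.Icc a b,
      HasDerivWithinAt w (A t * max 0 (min (p t) P)) (Set.Icc a b) t ∧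
      HasDerivWithinAt p (-(B t * g (max 0 (min (w t) M)))) (Set.Icc a b) t := by
  obtain ⟨K, hK⟩ := exists_lipschitz_clamp hg hM
  obtain ⟨CA, hCA⟩ := isCompact_Icc.exists_bound_of_continuousOn (hA.continuousOn (s := Set.Icc a b))
  obtain ⟨CB, hCB⟩ := isCompact_Icc.exists_bound_of_continuousOn (hB.continuousOn (s := Set.Icc a b))
  obtain ⟨Cg, hCg⟩ := isCompact_Icc.exists_bound_of_continuousOn
    (hg.continuous.continuousOn (s := Set.Icc 0 M))
  have hb : b ∈ Set.Icc a b := ⟨hab, le_rfl⟩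
  have hCA0 : 0 ≤ CA := (norm_nonneg _).trans (hCA b hb)
  have hCB0 : 0 ≤ CB := (norm_nonneg _).trans (hCB b hb)
  have hCg0 : 0 ≤ Cg := (norm_nonneg _).trans (hCg 0 ⟨le_rfl, hM⟩)
  let f : ℝ → ℝ × ℝ → ℝ × ℝ :=
    fun t x => (A t * max 0 (min x.2 P), -(B t * g (max 0 (min x.1 M))))
  suffices H : ∃ α : ℝ → ℝ × ℝ, α b = (x₀, p₀) ∧
      ∀ t ∈ Set.Icc a b, HasDerivWithinAt α (f t (α t)) (Set.Icc a b) t by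
    obtain ⟨α, h0, hα⟩ := H
    refine ⟨fun t => (α t).1, fun t => (α t).2, by simp [h0], by simp [h0], fun t ht => ⟨?_, ?_⟩⟩
    · exact (ContinuousLinearMap.fst ℝ ℝ ℝ).hasFDerivAt.comp_hasDerivWithinAt t (hα t ht)
    · exact (ContinuousLinearMap.snd ℝ ℝ ℝ).hasFDerivAt.comp_hasDerivWithinAt t (hα t ht)
  refine exists_hasDerivWithinAt_Icc_of_bounded hb
    (max ⟨CA * P, by positivity⟩ ⟨CB * Cg, by positivity⟩)
    (max ⟨CA, hCA0⟩ (⟨CB, hCB0⟩ * K)) ?_ ?_ ?_ (x₀, p₀)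
  · refine fun t ht => LipschitzWith.of_dist_le_mul fun x y => ?_
    have hx1 : |x.1 - y.1| ≤ dist x y := le_max_left _ _
    have hx2 : |x.2 - y.2| ≤ dist x y := le_max_right _ _
    refine max_le ?_ ?_
    · rw [Real.dist_eq, ← mul_sub, abs_mul]
      exact mul_le_mul ((hCA t ht).trans (le_max_left _ _))
        ((abs_clamp_sub_clamp_le 0 P _ _).trans hx2) (abs_nonneg _) (NNReal.coe_nonneg _)
    · rw [Real.dist_eq, neg_sub_neg, ← mul_sub, abs_mul, abs_sub_comm]
      calc |B t| * |g (max 0 (min x.1 M)) - g (max 0 (min y.1 M))|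
          ≤ CB * (K * |x.1 - y.1|) := mul_le_mul (hCB t ht) (hK _ _) (abs_nonneg _) hCB0
        _ = CB * K * |x.1 - y.1| := by ring
        _ ≤ _ := mul_le_mul (le_max_right _ _) hx1 (abs_nonneg _) (le_max_of_le_left hCA0)
  · exact fun x => Continuous.continuousOn (by fun_prop)
  · refine fun t ht x => max_le ?_ ?_
    · refine le_trans ?_ (le_max_left _ _)
      rw [norm_mul]
      refine mul_le_mul (hCA t ht) ?_ (norm_nonneg _) hCA0
      rw [Real.norm_of_nonneg (le_max_left _ _)]
      exact max_le hP (min_le_right _ _)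
    · refine le_trans ?_ (le_max_right _ _)
      rw [norm_neg, norm_mul]
      exact mul_le_mul (hCB t ht) (hCg _ ⟨le_max_left _ _, max_le hM (min_le_right _ _)⟩)
        (norm_nonneg _) hCB0

/-- A function with nonnegative derivative within a compact interval is monotone there. -/
theorem monotoneOn_Icc_of_hasDerivWithinAt {f f' : ℝ → ℝ} {a b : ℝ}
    (hf : ∀ t ∈ Set.Icc a b, HasDerivWithinAt f (f' t) (Set.Icc a b) t)
    (hf' : ∀ t ∈ Set.Icc a b, 0 ≤ f' t) : MonotoneOn f (Set.Icc a b) :=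
  monotoneOn_of_hasDerivWithinAt_nonneg (convex_Icc a b)
    (fun t ht => (hf t ht).continuousWithinAt)
    (fun t ht => (hf t (interior_subset ht)).mono interior_subset)
    fun t ht => hf' t (interior_subset ht)

theorem exists_backward_time {κ E M : ℝ} (hκ : 0 < κ) (hM : 0 ≤ M) (T : ℝ)
    (hE : E = Real.exp (-2 * T)) :
    ∃ T₁ ≤ T, M + E / (2 * κ) + E / κ * (T - T₁) - Real.exp (-2 * T₁) / (2 * κ) ≤ 0 := by
  have hE0 : 0 < E := hE ▸ Real.exp_pos _
  refine ⟨T - √(M * κ / E), by linarith [Real.sqrt_nonneg (M * κ / E)], ?_⟩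
  have hs := Real.sqrt_nonneg (M * κ / E)
  have hsq := Real.sq_sqrt (show 0 ≤ M * κ / E by positivity)
  set s := √(M * κ / E)
  have h := Real.quadratic_le_exp_of_nonneg (show 0 ≤ 2 * s by linarith)
  have he : Real.exp (-2 * (T - s)) = E * Real.exp (2 * s) := by
    rw [hE, ← Real.exp_add]; congr 1; ring
  have hM' : M = E * s ^ 2 / κ := by rw [hsq]; field_simp
  have hle : E * (1 + 2 * s + (2 * s) ^ 2 / 2) / (2 * κ) ≤ E * Real.exp (2 * s) / (2 * κ) := by
    gcongr
  rw [he]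
  have : M + E / (2 * κ) + E / κ * (T - (T - s))
      = E * (1 + 2 * s + (2 * s) ^ 2 / 2) / (2 * κ) := by
    rw [hM']; field_simp; ring
  linarith

/-- Continuing an increasing positive solution backwards in time, it reaches the value `0`. -/
theorem exists_backward_continuation (m : ℕ) {k : ℝ} (hk : 0 < k) (T : ℝ) {M V : ℝ}
    (hM : 0 < M) (hV : 0 < V) :
    ∃ S < T, ∃ w v : ℝ → ℝ, w T = M ∧ v T = V ∧ w S = 0 ∧
      (∀ t ∈ Set.Ioc S T, 0 < w t) ∧
      ∀ t ∈ Set.Icc S T, HasDerivWithinAt w (v t) (Set.Icc S T) t ∧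
        HasDerivWithinAt v (k * v t - Real.exp (-2 * t + iterExp m (w t))) (Set.Icc S T) t := by
  obtain ⟨T₁, hT₁, hneg⟩ := exists_backward_time (κ := k + 2) (by linarith) hM.le T rfl
  set κ := k + 2 with hκ
  have hκ0 : 0 < κ := by linarith
  set g := iterExp (m + 1) with hg
  have hgmono : Monotone g := iterExp_mono _
  have hg1 : ∀ y, 0 ≤ y → 1 ≤ g y := fun y hy => Real.one_le_exp (iterExp_nonneg m hy)
  have hcl : ∀ y, 0 ≤ max 0 (min y M) ∧ max 0 (min y M) ≤ M := fun y =>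
    ⟨le_max_left _ _, max_le hM.le (min_le_right _ _)⟩
  set p₀ := Real.exp (-k * T) * V with hp₀
  have hp₀pos : 0 < p₀ := mul_pos (Real.exp_pos _) hV
  set B₂ := Real.exp (-κ * T₁) * g M with hB₂
  have hB₂0 : 0 ≤ B₂ := mul_nonneg (Real.exp_pos _).le (by linarith [hg1 M hM.le])
  set P := p₀ + B₂ * (T - T₁) with hP
  have hPp : p₀ ≤ P := by
    have := mul_nonneg hB₂0 (sub_nonneg.2 hT₁)
    linarith
  obtain ⟨w, p, hwT, hpT, hwp⟩ := exists_truncated_solution (contDiff_iterExp (m + 1))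
    (A := fun t => Real.exp (k * t)) (B := fun t => Real.exp (-κ * t)) (by fun_prop) (by fun_prop)
    hT₁ hM.le (hp₀pos.le.trans hPp) M p₀
  have hTmem : T ∈ Set.Icc T₁ T := ⟨hT₁, le_rfl⟩
  have hclp : ∀ t ∈ Set.Icc T₁ T, p₀ ≤ p t ∧ p t ≤ P := by
    intro t ht
    constructor
    · have := monotoneOn_Icc_of_hasDerivWithinAt (fun t ht => (hwp t ht).2.neg) (fun t ht => by
        have := hg1 _ (hcl (w t)).1
        have := Real.exp_pos (-κ * t)
        rw [neg_neg]; positivity) ht hTmem ht.2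
      simp only [Pi.neg_apply, hpT] at this
      linarith
    · have := monotoneOn_Icc_of_hasDerivWithinAt
        (fun t ht => (hwp t ht).2.add ((hasDerivWithinAt_id t _).const_mul B₂)) (fun t ht => by
          have h1 : Real.exp (-κ * t) ≤ Real.exp (-κ * T₁) := Real.exp_le_exp.2 (by nlinarith [ht.1])
          have h2 := mul_le_mul h1 (hgmono (hcl (w t)).2) (by linarith [hg1 _ (hcl (w t)).1])
            (Real.exp_pos _).le
          rw [mul_one]; linarith) ht hTmem ht.2
      simp only [Pi.add_apply, hpT, id] at this
      have := mul_le_mul_of_nonneg_left ht.1 hB₂0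
      rw [hP]; linarith
  have hpP : ∀ t ∈ Set.Icc T₁ T, max 0 (min (p t) P) = p t := fun t ht => by
    rw [min_eq_left (hclp t ht).2, max_eq_right (hp₀pos.le.trans (hclp t ht).1)]
  have hdw : ∀ t ∈ Set.Icc T₁ T,
      HasDerivWithinAt w (Real.exp (k * t) * p t) (Set.Icc T₁ T) t := fun t ht => by
    have := (hwp t ht).1
    rwa [hpP t ht] at this
  have hexp : ∀ (c t : ℝ) (s : Set ℝ), HasDerivWithinAt (fun t => Real.exp (c * t))
      (Real.exp (c * t) * c) s t := fun c t s => by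
    simpa using (((hasDerivAt_id t).const_mul c).exp).hasDerivWithinAt
  have hplow : ∀ t ∈ Set.Icc T₁ T,
      Real.exp (-κ * t) / κ - Real.exp (-κ * T) / κ ≤ p t := fun t ht => by
    have := monotoneOn_Icc_of_hasDerivWithinAt
      (fun t ht => ((hexp (-κ) t _).div_const κ).sub (hwp t ht).2) (fun t ht => by
        have h1 := mul_le_mul_of_nonneg_left (hg1 _ (hcl (w t)).1) (Real.exp_pos (-κ * t)).le
        have : Real.exp (-κ * t) * -κ / κ = - Real.exp (-κ * t) := by field_simp
        rw [this]; linarith) ht hTmem ht.2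
    simp only [Pi.sub_apply, hpT] at this
    linarith
  have hwlow : w T₁ ≤ 0 := by
    have := monotoneOn_Icc_of_hasDerivWithinAt
      (fun t ht => ((hdw t ht).add ((hexp (-2) t _).div_const (2 * κ))).add
        ((hasDerivWithinAt_id t _).const_mul (Real.exp (-2 * T) / κ))) (fun t ht => by
        have h1 := mul_le_mul_of_nonneg_left (hplow t ht) (Real.exp_pos (k * t)).le
        have h2 : Real.exp (k * t) * Real.exp (-κ * t) = Real.exp (-2 * t) := by
          rw [← Real.exp_add]; congr 1; rw [hκ]; ring
        have h3 : Real.exp (k * t) * Real.exp (-κ * T) ≤ Real.exp (-2 * T) := by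
          rw [← Real.exp_add]; apply Real.exp_le_exp.2; rw [hκ]; nlinarith [ht.2]
        have h4 : Real.exp (-2 * t) * -2 / (2 * κ) = - (Real.exp (-2 * t) / κ) := by field_simp
        have h5 : Real.exp (k * t) * (Real.exp (-κ * t) / κ - Real.exp (-κ * T) / κ)
          = Real.exp (-2 * t) / κ - Real.exp (k * t) * Real.exp (-κ * T) / κ := by
            rw [← h2]; ring
        have h6 := div_le_div_of_nonneg_right h3 hκ0.le
        rw [h4, mul_one]; linarith) ⟨le_rfl, hT₁⟩ hTmem hT₁
    simp only [Pi.add_apply, hwT, id] at this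
    have h7 : Real.exp (-2 * T) / κ * (T - T₁)
      = Real.exp (-2 * T) / κ * T - Real.exp (-2 * T) / κ * T₁ := by ring
    linarith
  have hcont : ContinuousOn w (Set.Icc T₁ T) := fun t ht => (hdw t ht).continuousWithinAt
  have hstrict : StrictMonoOn w (Set.Icc T₁ T) :=
    strictMonoOn_of_hasDerivWithinAt_pos (convex_Icc _ _) hcont
      (fun t ht => (hdw t (interior_subset ht)).mono interior_subset)
      fun t ht => mul_pos (Real.exp_pos _)
        (hp₀pos.trans_le (hclp t (interior_subset ht)).1)
  obtain ⟨S, hS, hwS⟩ := intermediate_value_Icc hT₁ hcont ⟨hwlow, hwT ▸ hM.le⟩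
  have hST : S < T := lt_of_le_of_ne hS.2 fun h => by
    rw [h, hwT] at hwS; exact hM.ne' hwS
  have hsub : Set.Icc S T ⊆ Set.Icc T₁ T := Set.Icc_subset_Icc_left hS.1
  refine ⟨S, hST, w, fun t => Real.exp (k * t) * p t, hwT, ?_, hwS, fun t ht => ?_,
    fun t ht => ⟨(hdw t (hsub ht)).mono hsub, ?_⟩⟩
  · simp only [hpT, hp₀]
    rw [← mul_assoc, ← Real.exp_add]
    simp
  · rw [← hwS]
    exact hstrict hS (hsub ⟨ht.1.le, ht.2⟩) ht.1
  · have hw0 : 0 ≤ w t := hwS ▸ hstrict.monotoneOn hS (hsub ht) ht.1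
    have hwM : w t ≤ M := hwT ▸ hstrict.monotoneOn (hsub ht) hTmem ht.2
    have h := ((hexp k t _).mul (hwp t (hsub ht)).2).mono hsub
    rw [min_eq_left hwM, max_eq_right hw0] at h
    refine h.congr_deriv ?_
    have h2 : Real.exp (k * t) * Real.exp (-κ * t) = Real.exp (-2 * t) := by
      rw [← Real.exp_add]; congr 1; rw [hκ]; ring
    have h3 : iterExp (m + 1) (w t) = Real.exp (iterExp m (w t)) := rfl
    rw [Real.exp_add, ← h2, h3]
    ring

/-- Gluing two functions with matching values and derivatives at the junction point. -/
theorem hasDerivAt_ite_le {f f' g g' : ℝ → ℝ} {S T : ℝ}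
    (hf : ∀ t ∈ Set.Icc S T, HasDerivWithinAt f (f' t) (Set.Icc S T) t)
    (hg : ∀ t, T ≤ t → HasDerivAt g (g' t) t) (h : f T = g T) (h' : f' T = g' T) {t : ℝ}
    (ht : S < t) :
    HasDerivAt (fun t => if t ≤ T then f t else g t) (if t ≤ T then f' t else g' t) t := by
  rcases lt_trichotomy t T with htT | rfl | htT
  · rw [if_pos htT.le]
    refine ((hf t ⟨ht.le, htT.le⟩).hasDerivAt (Icc_mem_nhds ht htT)).congr_of_eventuallyEq ?_
    filter_upwards [Iio_mem_nhds htT] with s hs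
    exact if_pos (le_of_lt hs)
  · rw [if_pos le_rfl]
    have h1 : HasDerivWithinAt (fun s => if s ≤ t then f s else g s) (f' t) (Set.Icc S t) t :=
      (hf t ⟨ht.le, le_rfl⟩).congr (fun s hs => if_pos hs.2) (if_pos le_rfl)
    have h2 : HasDerivWithinAt (fun s => if s ≤ t then f s else g s) (f' t) (Set.Ici t) t := by
      rw [h']
      refine (hg t le_rfl).hasDerivWithinAt.congr (fun s hs => ?_) (by simp [h])
      rcases eq_or_lt_of_le (show t ≤ s from hs) with rfl | hs
      · simp [h]
      · exact if_neg hs.not_ge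
    refine (h1.union h2).hasDerivAt ?_
    filter_upwards [Ioi_mem_nhds ht] with s hs
    exact (le_total s t).imp (fun h => ⟨le_of_lt hs, h⟩) id
  · rw [if_neg htT.not_ge]
    refine (hg t htT.le).congr_of_eventuallyEq ?_
    filter_upwards [Ioi_mem_nhds htT] with s hs
    exact if_neg (not_le.2 hs)

/-- A solution of a first order system on an open half-line is twice continuously differentiable. -/
theorem contDiffOn_two_of_hasDerivAt {w v u : ℝ → ℝ} {S : ℝ}
    (hw : ∀ t, S < t → HasDerivAt w (v t) t) (hv : ∀ t, S < t → HasDerivAt v (u t) t)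
    (hu : ContinuousOn u (Set.Ioi S)) : ContDiffOn ℝ 2 w (Set.Ioi S) := by
  have hv1 : ContDiffOn ℝ 1 v (Set.Ioi S) := by
    rw [show (1 : WithTop ℕ∞) = 0 + 1 from (zero_add 1).symm,
      contDiffOn_succ_iff_deriv_of_isOpen isOpen_Ioi]
    refine ⟨fun t ht => (hv t ht).differentiableAt.differentiableWithinAt, by simp, ?_⟩
    exact contDiffOn_zero.2 (hu.congr fun t ht => (hv t ht).deriv)
  rw [show (2 : WithTop ℕ∞) = 1 + 1 from one_add_one_eq_two.symm,
    contDiffOn_succ_iff_deriv_of_isOpen isOpen_Ioi]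
  exact ⟨fun t ht => (hw t ht).differentiableAt.differentiableWithinAt, by simp,
    hv1.congr fun t ht => (hw t ht).deriv⟩

open Filter in
theorem eventually_deriv_iterLog (m : ℕ) :
    ∀ᶠ t : ℝ in atTop, deriv (iterLog m) (2 * t) = Real.exp (-logSum m (2 * t)) :=
  (tendsto_two_mul_atTop.eventually (eventually_hasDerivAt_iterLog m)).mono fun _ h => h.deriv

open Filter in
theorem eventually_iterLog_phiIter (m : ℕ) {n : ℕ} (hn : 3 ≤ n) :
    ∀ᶠ t : ℝ in atTop, iterLog m (2 * t + phiIter m n t) = approx m ((n : ℝ) - 2) t := by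
  have hn' : (3 : ℝ) ≤ n := by exact_mod_cast hn
  filter_upwards [eventually_deriv_iterLog m] with t ht
  rw [phiIter, ht, Real.log_mul (by linarith) (Real.exp_pos _).ne', Real.log_exp]
  rfl

/-- ODE form of Theorem 3: for `m ≥ 2`, `n ≥ 3`, there exist `T*` and
`w`, continuous on `[T*, ∞)` and `C²` on `(T*, ∞)`, with
`w'' - (n-2) w' + exp(-2t + G_m(w)) = 0`, `w > 0` on `(T*, ∞)`, `w(T*) = 0`,
`w(t) = H_m(2t + φ(t)) + O(1/t²)` and `w'(t) = 2 H_m'(2t) + O(1/t²)` as `t → ∞`. -/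
theorem singular_solution_iterated_exp (m n : ℕ) (hm : 2 ≤ m) (hn : 3 ≤ n) :
    ∃ (Tstar : ℝ) (w : ℝ → ℝ),
      ContinuousOn w (Set.Ici Tstar) ∧
      ContDiffOn ℝ 2 w (Set.Ioi Tstar) ∧
      (∀ t > Tstar,
        deriv (deriv w) t - ((n : ℝ) - 2) * deriv w t
            + Real.exp (-2 * t + iterExp m (w t)) = 0 ∧ 0 < w t) ∧
      w Tstar = 0 ∧
      (∃ C > (0 : ℝ), ∃ T > (0 : ℝ), ∀ t > T,
        |w t - iterLog m (2 * t + phiIter m n t)| ≤ C / t ^ 2) ∧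
      (∃ C > (0 : ℝ), ∃ T > (0 : ℝ), ∀ t > T,
        |deriv w t - 2 * deriv (iterLog m) (2 * t)| ≤ C / t ^ 2) := by
  have hn' : (3 : ℝ) ≤ n := by exact_mod_cast hn
  have hk : (0 : ℝ) < (n : ℝ) - 2 := by linarith
  obtain ⟨T, hT, C, hC, w₁, v₁, h₁⟩ := exists_solution_near_infinity hm hk
  obtain ⟨S, hST, w₀, v₀, hwT, hvT, hwS, hpos, h₀⟩ :=
    exists_backward_continuation m hk T (h₁ T le_rfl).2.2.1 (h₁ T le_rfl).2.2.2.1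
  set w : ℝ → ℝ := fun t => if t ≤ T then w₀ t else w₁ t with hw_def
  set v : ℝ → ℝ := fun t => if t ≤ T then v₀ t else v₁ t with hv_def
  have hw : ∀ t, S < t → HasDerivAt w (v t) t := fun t ht =>
    hasDerivAt_ite_le (fun t ht => (h₀ t ht).1) (fun t ht => (h₁ t ht).1) hwT hvT ht
  have hv : ∀ t, S < t → HasDerivAt v
      (((n : ℝ) - 2) * v t - Real.exp (-2 * t + iterExp m (w t))) t := fun t ht => by
    refine (hasDerivAt_ite_le (fun t ht => (h₀ t ht).2) (fun t ht => (h₁ t ht).2.1) hvT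
      (by rw [hwT, hvT]) ht).congr_deriv ?_
    by_cases htT : t ≤ T <;> simp [hw_def, hv_def, htT]
  have hwc : ContinuousOn w (Set.Ioi S) := fun t ht => (hw t ht).continuousAt.continuousWithinAt
  have hvc : ContinuousOn v (Set.Ioi S) := fun t ht => (hv t ht).continuousAt.continuousWithinAt
  have hlarge : ∀ t, T < t → w t = w₁ t ∧ deriv w t = v₁ t := fun t ht =>
    ⟨if_neg ht.not_ge, (hw t (hST.trans ht)).deriv.trans (if_neg ht.not_ge)⟩
  refine ⟨S, w, fun t ht => ?_, contDiffOn_two_of_hasDerivAt hw hv ?_, fun t ht => ⟨?_, ?_⟩, ?_,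
    ?_, ?_⟩
  · rcases eq_or_lt_of_le (show S ≤ t from ht) with rfl | ht
    · have h : ContinuousWithinAt w (Set.Icc S T) S :=
        (h₀ S ⟨le_rfl, hST.le⟩).1.continuousWithinAt.congr (fun s hs => if_pos hs.2)
          (if_pos hST.le)
      exact h.mono_of_mem_nhdsWithin (Icc_mem_nhdsGE hST)
    · exact (hw t ht).continuousAt.continuousWithinAt
  · have hG : ContinuousOn (fun t => iterExp m (w t)) (Set.Ioi S) :=
      (contDiff_iterExp m).continuous.comp_continuousOn hwc
    fun_prop
  · have hd : deriv w =ᶠ[nhds t] v := by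
      filter_upwards [Ioi_mem_nhds ht] with s hs using (hw s hs).deriv
    rw [hd.deriv_eq, hd.eq_of_nhds, (hv t ht).deriv]
    ring
  · by_cases htT : t ≤ T
    · simpa [hw_def, htT] using hpos t ⟨ht, htT⟩
    · simpa [hw_def, htT] using (h₁ t (not_le.1 htT).le).2.2.1
  · simpa [hw_def, hST.le] using hwS
  · obtain ⟨T', hT'⟩ := Filter.eventually_atTop.1 (eventually_iterLog_phiIter m hn)
    refine ⟨C, hC, max T T', lt_max_of_lt_left hT, fun t ht => ?_⟩
    obtain ⟨ht, ht'⟩ := max_lt_iff.1 ht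
    rw [hT' t ht'.le, (hlarge t ht).1]
    exact (h₁ t ht.le).2.2.2.2.1
  · obtain ⟨T', hT'⟩ := Filter.eventually_atTop.1 (eventually_deriv_iterLog m)
    refine ⟨C, hC, max T T', lt_max_of_lt_left hT, fun t ht => ?_⟩
    obtain ⟨ht, ht'⟩ := max_lt_iff.1 ht
    rw [hT' t ht'.le, (hlarge t ht).2]
    exact (h₁ t ht.le).2.2.2.2.2
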